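/- arXiv:1009.2282 — 3 statements merged into one kernel-verified Lean document; each statement's English description precedes it below -/
import Mathlib

section
/- Let d̄ > 0 and t > 0 be real numbers, and let D : ℕ → ℝ satisfy D(0) = 0 and, for every k ≥ 1, the snowball-tree per-level average-delay recursion D(k) = 2^{-(k-1)} · [ (D(0) + d̄ + k·t) + Σ_{i=1}^{k-1} 2^{i-1} · ( D(i) + d̄ + (k-i)·t ) ]. Then for every k ≥ 1, D(k) = ((k+1)/2)·d̄ + k·t; equivalently, D(k) is the arithmetic mean of the minimum level-k delay d̄ + k·t and the maximum level-k delay k·(d̄ + t). -/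
theorem sum_two_pow_mul_affine (d c : ℝ) (n : ℕ) :
    ∑ i ∈ Finset.Icc 1 n, (2 : ℝ) ^ (i - 1) * (((i : ℝ) + 3) / 2 * d + c) =
      2 ^ n * (((n : ℝ) + 2) / 2 * d + c) - d - c := by
  induction n with
  | zero => simp
  | succ n ih =>
    rw [Finset.sum_Icc_succ_top (by omega), ih, Nat.add_sub_cancel]
    push_cast
    ring

/-- Snowball-tree per-level average-delay recursion: if `D 0 = 0` and for every
`k ≥ 1`, `D k = 2^{-(k-1)} * ((D 0 + d̄ + k·t) + Σ_{i=1}^{k-1} 2^{i-1} (D i + d̄ + (k-i)·t))`,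
then `D k = ((k+1)/2)·d̄ + k·t` for all `k ≥ 1` (the mean of the min and max level-`k` delays). -/
theorem snowball_level_average_delay
    (dbar t : ℝ) (hd : 0 < dbar) (ht : 0 < t) (D : ℕ → ℝ)
    (h0 : D 0 = 0)
    (hrec : ∀ k : ℕ, 1 ≤ k →
      D k = (2 : ℝ) ^ (-((k : ℤ) - 1)) *
        ((D 0 + dbar + (k : ℝ) * t) +
          ∑ i ∈ Finset.Icc 1 (k - 1),
            (2 : ℝ) ^ (i - 1) * (D i + dbar + ((k : ℝ) - (i : ℝ)) * t))) :
    ∀ k : ℕ, 1 ≤ k → D k = (((k : ℝ) + 1) / 2) * dbar + (k : ℝ) * t := by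
  intro k
  induction k using Nat.strong_induction_on with
  | _ k ih =>
    intro hk
    obtain ⟨n, rfl⟩ := Nat.exists_eq_add_of_le' hk
    have hsum : ∑ i ∈ Finset.Icc 1 n,
        (2 : ℝ) ^ (i - 1) * (D i + dbar + (((n + 1 : ℕ) : ℝ) - (i : ℝ)) * t) =
        ∑ i ∈ Finset.Icc 1 n,
          (2 : ℝ) ^ (i - 1) * (((i : ℝ) + 3) / 2 * dbar + ((n : ℝ) + 1) * t) := by
      refine Finset.sum_congr rfl fun i hi => ?_
      rw [Finset.mem_Icc] at hi
      rw [ih i (by omega) hi.1]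
      push_cast
      ring
    have hpow : (2 : ℝ) ^ (-(((n + 1 : ℕ) : ℤ) - 1)) = (2 ^ n)⁻¹ := by
      rw [zpow_neg, Nat.cast_succ, add_sub_cancel_right, zpow_natCast]
    rw [hrec _ hk, hpow, Nat.add_sub_cancel, hsum, sum_two_pow_mul_affine, h0,
      inv_mul_eq_iff_eq_mul₀ (by positivity)]
    push_cast
    ring
end

section
/- Let N ≥ 6 be an integer and let d̄, t be real numbers with 0 < d̄ ≤ t. Then ⌈log₂ N⌉ · (d̄ + t) < d̄ + N·t; that is, the maximum delay of the snowball tree, D_max^{SBT} = ⌈log₂ N⌉·(d̄ + t), is strictly smaller than the maximum delay of the optimal packet streaming tree, D_max^{OPST} = d̄ + N·t. -/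
theorem two_mul_add_one_le_two_pow {m : ℕ} (hm : 3 ≤ m) : 2 * m + 1 ≤ 2 ^ m := by
  induction m, hm using Nat.le_induction with
  | base => norm_num
  | succ k hk ih => rw [pow_succ]; omega

theorem two_mul_clog_two_le {N : ℕ} (hN : 6 ≤ N) : 2 * Nat.clog 2 N ≤ N := by
  have hpow : 2 * (N / 2) + 1 ≤ 2 ^ (N / 2) := two_mul_add_one_le_two_pow (by omega)
  have hclog : Nat.clog 2 N ≤ N / 2 := Nat.clog_le_of_le_pow (by omega)
  omega

/-- For `N ≥ 6` and `0 < d̄ ≤ t`, the snowball-tree maximum delay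
`⌈log₂ N⌉·(d̄ + t)` is strictly smaller than the OPST maximum delay `d̄ + N·t`. -/
theorem SBT_max_delay_lt_OPST_max_delay
    (N : ℕ) (hN : 6 ≤ N) (dbar t : ℝ) (hd : 0 < dbar) (hdt : dbar ≤ t) :
    (Nat.clog 2 N : ℝ) * (dbar + t) < dbar + (N : ℝ) * t := by
  have hclog : 2 * (Nat.clog 2 N : ℝ) ≤ N := by exact_mod_cast two_mul_clog_two_le hN
  have ht : 0 ≤ t := hd.le.trans hdt
  calc (Nat.clog 2 N : ℝ) * (dbar + t) ≤ Nat.clog 2 N * (t + t) := by gcongr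
    _ = 2 * Nat.clog 2 N * t := by ring
    _ ≤ N * t := by gcongr
    _ < dbar + N * t := lt_add_of_pos_left _ hd
end

section
/- Let N ≥ 2 be an integer, let d̄ > 0, set t = d̄, and let K = ⌈log₂ N⌉. Then (K/2)·d̄ + (K-1)·t + t/2^{K} < d̄ + ((N+1)/2)·t; that is, the average delay of the snowball tree is strictly smaller than the average delay d̄ + 0.5·(N+1)·t of the optimal packet streaming tree. -/
theorem three_mul_le_two_pow_add_two (m : ℕ) : 3 * m ≤ 2 ^ m + 2 := by
  rcases Nat.lt_or_ge m 3 with h | h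
  · interval_cases m <;> norm_num
  · induction m, h using Nat.le_induction with
    | base => norm_num
    | succ n hn ih => rw [pow_succ]; omega

/-- For `N ≥ 2`, `d̄ > 0`, `t = d̄`, and `K = ⌈log₂ N⌉`, the snowball-tree average delay
`(K/2)·d̄ + (K-1)·t + t/2^K` is strictly smaller than the OPST average delay
`d̄ + ((N+1)/2)·t`. -/
theorem SBT_avg_delay_lt_OPST_avg_delay
    (N : ℕ) (hN : 2 ≤ N) (dbar t : ℝ) (hd : 0 < dbar) (hts : t = dbar)
    (K : ℕ) (hK : K = Nat.clog 2 N) :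
    ((K : ℝ) / 2) * dbar + ((K : ℝ) - 1) * t + t / 2 ^ K
      < dbar + (((N : ℝ) + 1) / 2) * t := by
  subst hts
  have hpos : 0 < K := hK ▸ Nat.clog_pos one_lt_two hN
  obtain ⟨m, rfl⟩ : ∃ m, K = m + 1 := ⟨K - 1, by omega⟩
  have hlt : 2 ^ m < N := (Nat.lt_clog_iff_pow_lt one_lt_two).1 (by omega)
  have hm : 3 * m ≤ N + 1 := by
    have := three_mul_le_two_pow_add_two m
    omega
  have hmR : 3 * (m : ℝ) ≤ N + 1 := by exact_mod_cast hm
  have hNR : (2 : ℝ) ≤ N := by exact_mod_cast hN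
  have key : 3 * (m : ℝ) + 2 * (1 / 2 ^ (m + 1)) < N + 2 := by
    rcases Nat.eq_zero_or_pos m with rfl | h
    · norm_num
      linarith
    · have hpow : (2 : ℝ) < 2 ^ (m + 1) := by
        simpa using pow_lt_pow_right₀ (one_lt_two : (1 : ℝ) < 2) (by omega : 1 < m + 1)
      have : (1 : ℝ) / 2 ^ (m + 1) < 1 / 2 := one_div_lt_one_div_of_lt two_pos hpow
      linarith
  rw [div_eq_mul_one_div t]
  push_cast
  nlinarith [mul_lt_mul_of_pos_left key hd]
end
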